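/- arXiv:2603.10932 — 3 statements merged into one kernel-verified Lean document; each statement's English description precedes it below -/
import Mathlib

section
/- Fix positive integers S ≤ N. Index the 2N columns by Fin N ⊕ Fin N (the first N columns are the 'X part', the last N the 'Z part'). Let 𝒯 be the subgroup of GL(Fin N ⊕ Fin N, 𝔽₂) generated by the following elementary matrices: (i) for each j, the 'Hadamard' matrix swapping column j of the X part with column j of the Z part; (ii) for each j, the 'phase' matrix adding column j of the X part to column j of the Z part; (iii) for each ordered pair i ≠ j, the 'CNOT' matrix that simultaneously adds column i of the X part to column j of the X part and adds column j of the Z part to column i of the Z part. Suppose A, B ∈ 𝔽₂^{S×N} are such that the S×2N block matrix (A | B) has rank S and A * Bᵀ is a symmetric matrix. Then there exists T ∈ 𝒯 such that (A | B) * T = (0 | C) where C ∈ 𝔽₂^{S×N} has C i j = 1 if i = j (as elements of Fin S embedded in Fin N) and C i j = 0 otherwise. -/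
/-!
STATEMENT 1 (Theorem C.3): any stabilizer tableau `(A | B)` of `S` independent, mutually
commuting generators (rank `S`, `A * Bᵀ` symmetric) can be brought to the canonical form
`(0 | I 0)` by right multiplication with an element of the group generated by the
elementary column operations corresponding to Hadamard, phase and CNOT gates.

The columns are indexed by `Fin N ⊕ Fin N`: the `Sum.inl` columns are the X part and the
`Sum.inr` columns are the Z part.  Every generator below is an involution over `𝔽₂`
(hence invertible), so the submonoid they generate coincides with the generated subgroup
of `GL (Fin N ⊕ Fin N) 𝔽₂`.
-/

open Matrix

/-- Columns of a tableau on `N` qubits: X part ⊕ Z part. -/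
abbrev TabCol (N : ℕ) := Fin N ⊕ Fin N

/-- The "Hadamard" elementary matrix on qubit `j`: right multiplication by it swaps
column `j` of the X part with column `j` of the Z part (a permutation matrix). -/
def hadamardMat (N : ℕ) (j : Fin N) : Matrix (TabCol N) (TabCol N) (ZMod 2) :=
  Matrix.of fun c k => if k = (Equiv.swap (Sum.inl j) (Sum.inr j)) c then 1 else 0

/-- The "phase" elementary matrix on qubit `j`: right multiplication by it adds
column `j` of the X part to column `j` of the Z part. -/
def phaseMat (N : ℕ) (j : Fin N) : Matrix (TabCol N) (TabCol N) (ZMod 2) :=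
  1 + Matrix.single (Sum.inl j) (Sum.inr j) 1

/-- The "CNOT" elementary matrix with control `i` and target `j`: right multiplication by
it adds column `i` of the X part to column `j` of the X part and simultaneously adds
column `j` of the Z part to column `i` of the Z part. -/
def cnotMat (N : ℕ) (i j : Fin N) : Matrix (TabCol N) (TabCol N) (ZMod 2) :=
  1 + Matrix.single (Sum.inl i) (Sum.inl j) 1 +
    Matrix.single (Sum.inr j) (Sum.inr i) 1

/-- The group 𝒯 of tableau column operations generated by the Hadamard, phase and CNOT
elementary matrices (as a submonoid of matrices; all generators are invertible, and every
element of the closure is an invertible matrix). -/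
def tableauGroup (N : ℕ) : Submonoid (Matrix (TabCol N) (TabCol N) (ZMod 2)) :=
  Submonoid.closure
    (Set.range (hadamardMat N) ∪ Set.range (phaseMat N) ∪
      {T | ∃ i j : Fin N, i ≠ j ∧ T = cnotMat N i j})

theorem tg_vecMul_hadamard {N : ℕ} (v : TabCol N → ZMod 2) (j : Fin N) (c : TabCol N) :
    (v ᵥ* hadamardMat N j) c = v (Equiv.swap (Sum.inl j) (Sum.inr j) c) := by
  have h : ∀ d : TabCol N, (c = Equiv.swap (Sum.inl j) (Sum.inr j) d) ↔
      (Equiv.swap (Sum.inl j) (Sum.inr j) c = d) := by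
    intro d
    constructor
    · rintro rfl; simp
    · rintro rfl; simp
  simp [vecMul, dotProduct, hadamardMat, h]

theorem tg_vecMul_phase {N : ℕ} (v : TabCol N → ZMod 2) (j : Fin N) (c : TabCol N) :
    (v ᵥ* phaseMat N j) c = v c + if c = Sum.inr j then v (Sum.inl j) else 0 := by
  rw [phaseMat, vecMul_add, vecMul_one, Pi.add_apply]
  congr 1
  by_cases h : c = Sum.inr j
  · subst h; simp [vecMul, dotProduct, Matrix.single_apply]
  · simp [vecMul, dotProduct, Matrix.single_apply, h, Ne.symm h]

theorem tg_vecMul_cnot {N : ℕ} (v : TabCol N → ZMod 2) (i j : Fin N) (c : TabCol N) :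
    (v ᵥ* cnotMat N i j) c = v c + (if c = Sum.inl j then v (Sum.inl i) else 0)
      + (if c = Sum.inr i then v (Sum.inr j) else 0) := by
  rw [cnotMat, vecMul_add, vecMul_add, vecMul_one, Pi.add_apply, Pi.add_apply]
  have key : ∀ a b : TabCol N, (v ᵥ* (Matrix.single a b (1 : ZMod 2))) c
      = if c = b then v a else 0 := by
    intro a b
    by_cases h : c = b
    · subst h; simp [vecMul, dotProduct, Matrix.single_apply]
    · simp [vecMul, dotProduct, Matrix.single_apply, h, Ne.symm h]
  rw [key, key]

theorem tg_had_mem {N : ℕ} (j : Fin N) : hadamardMat N j ∈ tableauGroup N :=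
  Submonoid.subset_closure (Or.inl (Or.inl ⟨j, rfl⟩))

theorem tg_phase_mem {N : ℕ} (j : Fin N) : phaseMat N j ∈ tableauGroup N :=
  Submonoid.subset_closure (Or.inl (Or.inr ⟨j, rfl⟩))

theorem tg_cnot_mem {N : ℕ} {i j : Fin N} (h : i ≠ j) : cnotMat N i j ∈ tableauGroup N :=
  Submonoid.subset_closure (Or.inr ⟨i, j, h, rfl⟩)

/-- The symplectic form. -/
def tgOmega {N : ℕ} (v w : TabCol N → ZMod 2) : ZMod 2 :=
  ∑ i, (v (Sum.inl i) * w (Sum.inr i) + v (Sum.inr i) * w (Sum.inl i))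

theorem tg_omega {N : ℕ} {T : Matrix (TabCol N) (TabCol N) (ZMod 2)} (hT : T ∈ tableauGroup N) :
    ∀ v w : TabCol N → ZMod 2, tgOmega (v ᵥ* T) (w ᵥ* T) = tgOmega v w := by
  induction hT using Submonoid.closure_induction with
  | one => simp
  | mul x y _ _ hx hy =>
    intro v w
    rw [← vecMul_vecMul, ← vecMul_vecMul, hy, hx]
  | mem x hx =>
    intro v w
    rcases hx with (⟨j, rfl⟩ | ⟨j, rfl⟩) | ⟨i, j, hij, rfl⟩
    · unfold tgOmega
      refine Finset.sum_congr rfl fun i _ => ?_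
      simp only [tg_vecMul_hadamard]
      by_cases h : i = j
      · subst h; simp; ring
      · rw [Equiv.swap_apply_of_ne_of_ne, Equiv.swap_apply_of_ne_of_ne] <;> simp [h]
    · unfold tgOmega
      simp only [tg_vecMul_phase]
      simp [add_mul, mul_add, Finset.sum_add_distrib]
      have := CharTwo.add_self_eq_zero (v (Sum.inl j) * w (Sum.inl j))
      linear_combination this
    · unfold tgOmega
      simp only [tg_vecMul_cnot]
      simp [add_mul, mul_add, Finset.sum_add_distrib, hij, hij.symm]
      have h1 := CharTwo.add_self_eq_zero (v (Sum.inl i) * w (Sum.inr j))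
      have h2 := CharTwo.add_self_eq_zero (v (Sum.inr j) * w (Sum.inl i))
      linear_combination h1 + h2

theorem tg_inj {N : ℕ} {T : Matrix (TabCol N) (TabCol N) (ZMod 2)} (hT : T ∈ tableauGroup N)
    (v : TabCol N → ZMod 2) (h : v ᵥ* T = 0) : v = 0 := by
  have h0 : ∀ w, tgOmega v w = 0 := by
    intro w
    rw [← tg_omega hT, h]
    simp [tgOmega]
  funext c
  rcases c with c | c
  · simpa [tgOmega, Pi.single_apply] using h0 (Pi.single (Sum.inr c) 1)
  · simpa [tgOmega, Pi.single_apply] using h0 (Pi.single (Sum.inl c) 1)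

/-- The vector with a single one in column `i` of the Z part. -/
def tgZ {N : ℕ} (i : Fin N) : TabCol N → ZMod 2 := Pi.single (Sum.inr i) 1

/-- `w` can be moved to `w'` fixing the first `k` Z vectors. -/
def tgR {N : ℕ} (k : Fin N) (w w' : TabCol N → ZMod 2) : Prop :=
  ∃ T ∈ tableauGroup N, (∀ i < k, tgZ i ᵥ* T = tgZ i) ∧ w ᵥ* T = w'

theorem tgR_refl {N : ℕ} (k : Fin N) (w : TabCol N → ZMod 2) : tgR k w w :=
  ⟨1, one_mem _, by simp, by simp⟩

theorem tgR_trans {N : ℕ} {k : Fin N} {a b c : TabCol N → ZMod 2} (h1 : tgR k a b)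
    (h2 : tgR k b c) : tgR k a c := by
  obtain ⟨T, hT, hf, rfl⟩ := h1
  obtain ⟨U, hU, hg, rfl⟩ := h2
  refine ⟨T * U, mul_mem hT hU, fun i hi => ?_, by rw [vecMul_vecMul]⟩
  rw [← vecMul_vecMul, hf i hi, hg i hi]

theorem tgR_had {N : ℕ} (k j : Fin N) (hj : k ≤ j) (w : TabCol N → ZMod 2) :
    tgR k w (fun c => w (Equiv.swap (Sum.inl j) (Sum.inr j) c)) := by
  refine ⟨_, tg_had_mem j, fun i hi => ?_, funext fun c => tg_vecMul_hadamard w j c⟩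
  have hij : i ≠ j := by rintro rfl; exact absurd hi (not_lt.2 hj)
  have hji := hij.symm
  funext c
  rw [tg_vecMul_hadamard]
  simp only [tgZ, Pi.single_apply, Equiv.swap_apply_def]
  rcases c with c | c <;> simp <;> split_ifs <;> simp_all

theorem tgR_phase {N : ℕ} (k j : Fin N) (w : TabCol N → ZMod 2) :
    tgR k w (fun c => w c + if c = Sum.inr j then w (Sum.inl j) else 0) := by
  refine ⟨_, tg_phase_mem j, fun i hi => ?_, funext fun c => tg_vecMul_phase w j c⟩
  funext c
  rw [tg_vecMul_phase]
  simp [tgZ]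

theorem tgR_cnot {N : ℕ} (k i j : Fin N) (hij : i ≠ j) (hj : k ≤ j)
    (w : TabCol N → ZMod 2) :
    tgR k w (fun c => w c + (if c = Sum.inl j then w (Sum.inl i) else 0)
      + (if c = Sum.inr i then w (Sum.inr j) else 0)) := by
  refine ⟨_, tg_cnot_mem hij, fun l hl => ?_, funext fun c => tg_vecMul_cnot w i j c⟩
  have hlj : j ≠ l := by rintro rfl; exact absurd hl (not_lt.2 hj)
  funext c
  rw [tg_vecMul_cnot]
  simp [tgZ, Pi.single_apply, hlj]

theorem tgR_cz {N : ℕ} (k i j : Fin N) (hij : i ≠ j) (w : TabCol N → ZMod 2) :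
    tgR k w (fun c => w c + (if c = Sum.inr j then w (Sum.inl i) else 0)
      + (if c = Sum.inr i then w (Sum.inl j) else 0)) := by
  have form : ∀ v : TabCol N → ZMod 2,
      v ᵥ* (hadamardMat N j * cnotMat N i j * hadamardMat N j) =
      (fun c => v c + (if c = Sum.inr j then v (Sum.inl i) else 0)
      + (if c = Sum.inr i then v (Sum.inl j) else 0)) := by
    intro v
    funext c
    rw [← vecMul_vecMul, ← vecMul_vecMul, tg_vecMul_hadamard, tg_vecMul_cnot]
    simp only [tg_vecMul_hadamard, Equiv.swap_apply_def]
    rcases c with c | c <;> simp <;> split_ifs <;> simp_all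
  refine ⟨_, mul_mem (mul_mem (tg_had_mem j) (tg_cnot_mem hij)) (tg_had_mem j),
    fun l hl => ?_, form w⟩
  rw [form]
  funext c
  simp [tgZ]

theorem tg_z2 (x : ZMod 2) (h : x ≠ 0) : x = 1 := by
  revert x; decide

/-- Clearing the Z part. -/
theorem tg_clearZ {N : ℕ} (k : Fin N) : ∀ (n : ℕ) (w : TabCol N → ZMod 2),
    (∀ j, w (Sum.inl j) = if j = k then 1 else 0) →
    (Finset.univ.filter fun j => w (Sum.inr j) ≠ 0).card = n →
    tgR k w (Pi.single (Sum.inl k) 1) := by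
  intro n
  induction n with
  | zero =>
    intro w hX hc
    rw [Finset.card_eq_zero, Finset.filter_eq_empty_iff] at hc
    have : w = Pi.single (Sum.inl k) 1 := by
      funext c
      rcases c with c | c
      · rw [hX]; simp [Pi.single_apply]
      · simpa using hc (Finset.mem_univ c)
    rw [this]
    exact tgR_refl _ _
  | succ n ih =>
    intro w hX hc
    obtain ⟨j, hj⟩ := Finset.card_pos.1 (lt_of_lt_of_eq (Nat.succ_pos n) hc.symm)
    have hj1 := tg_z2 _ (Finset.mem_filter.1 hj).2
    have main : ∀ w', tgR k w w' → (∀ j, w' (Sum.inl j) = w (Sum.inl j)) →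
        (∀ l, w' (Sum.inr l) = if l = j then 0 else w (Sum.inr l)) →
        tgR k w (Pi.single (Sum.inl k) 1) := by
      intro w' hR hX' hZ'
      refine tgR_trans hR (ih w' (fun l => by rw [hX', hX]) ?_)
      have : (Finset.univ.filter fun j => w' (Sum.inr j) ≠ 0) =
          (Finset.univ.filter fun j => w (Sum.inr j) ≠ 0).erase j := by
        ext l
        simp [hZ']
      rw [this, Finset.card_erase_of_mem hj, hc]
      rfl
    have h11 : (1 : ZMod 2) + 1 = 0 := by decide
    by_cases hjk : j = k
    · subst hjk
      refine main _ (tgR_phase j j w) (by simp) fun l => ?_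
      by_cases h : l = j
      · subst h; simp [hX, hj1, h11]
      · simp [h]
    · refine main _ (tgR_cz k k j (Ne.symm hjk) w) (by simp) fun l => ?_
      by_cases h : l = j
      · subst h; simp [hX, hj1, h11, hjk]
      · simp [h, hX, hjk]

/-- Clearing the X part. -/
theorem tg_clearX {N : ℕ} (k : Fin N) : ∀ (n : ℕ) (w : TabCol N → ZMod 2),
    w (Sum.inl k) = 1 → (∀ j < k, w (Sum.inl j) = 0) →
    (Finset.univ.filter fun j => j ≠ k ∧ w (Sum.inl j) ≠ 0).card = n →
    tgR k w (Pi.single (Sum.inl k) 1) := by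
  intro n
  induction n with
  | zero =>
    intro w hk hX hc
    rw [Finset.card_eq_zero, Finset.filter_eq_empty_iff] at hc
    refine tg_clearZ k _ w (fun j => ?_) rfl
    by_cases h : j = k
    · subst h; simp [hk]
    · have := hc (Finset.mem_univ j)
      simp only [h, if_false]
      by_contra h'
      exact this ⟨h, h'⟩
  | succ n ih =>
    intro w hk hX hc
    obtain ⟨j, hj⟩ := Finset.card_pos.1 (lt_of_lt_of_eq (Nat.succ_pos n) hc.symm)
    obtain ⟨hjk, hj0⟩ := (Finset.mem_filter.1 hj).2
    have hj1 := tg_z2 _ hj0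
    have hkj : k ≤ j := by
      by_contra h
      exact hj0 (hX j (not_le.1 h))
    have h11 : (1 : ZMod 2) + 1 = 0 := by decide
    refine tgR_trans (tgR_cnot k k j (Ne.symm hjk) hkj w) (ih _ ?_ ?_ ?_)
    · simp [hk, Ne.symm hjk]
    · intro l hl
      have : l ≠ j := by rintro rfl; exact absurd hl (not_lt.2 hkj)
      simp [this, hX l hl]
    · have : (Finset.univ.filter fun l => l ≠ k ∧
          (w (Sum.inl l) + (if (Sum.inl l : TabCol N) = Sum.inl j then w (Sum.inl k) else 0)
            + (if (Sum.inl l : TabCol N) = Sum.inr k then w (Sum.inr j) else 0)) ≠ 0) =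
          (Finset.univ.filter fun j => j ≠ k ∧ w (Sum.inl j) ≠ 0).erase j := by
        ext l
        by_cases h : l = j
        · subst h; simp [hk, hj1, h11]
        · simp [h]
      rw [this, Finset.card_erase_of_mem hj, hc]
      rfl

theorem tg_step2 {N : ℕ} (k : Fin N) (w : TabCol N → ZMod 2)
    (hX : ∀ j < k, w (Sum.inl j) = 0) (j : Fin N) (hkj : k ≤ j) (hj : w (Sum.inl j) = 1) :
    tgR k w (Pi.single (Sum.inl k) 1) := by
  by_cases h : w (Sum.inl k) = 0
  · have hjk : j ≠ k := by rintro rfl; simp [h] at hj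
    refine tgR_trans (tgR_cnot k j k hjk le_rfl w) (tg_clearX k _ _ ?_ ?_ rfl)
    · simp [h, hj]
    · intro l hl
      simp [hl.ne, hX l hl]
  · exact tg_clearX k _ w (tg_z2 _ h) hX rfl

theorem tg_step {N : ℕ} (k : Fin N) (w : TabCol N → ZMod 2)
    (hX : ∀ j < k, w (Sum.inl j) = 0)
    (hne : ∃ j, k ≤ j ∧ (w (Sum.inl j) ≠ 0 ∨ w (Sum.inr j) ≠ 0)) :
    tgR k w (tgZ k) := by
  have h1 : tgR k w (Pi.single (Sum.inl k) 1) := by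
    obtain ⟨j, hkj, h | h⟩ := hne
    · exact tg_step2 k w hX j hkj (tg_z2 _ h)
    · refine tgR_trans (tgR_had k j hkj w) (tg_step2 k _ ?_ j hkj ?_)
      · intro l hl
        have : l ≠ j := by rintro rfl; exact absurd hl (not_lt.2 hkj)
        rw [Equiv.swap_apply_of_ne_of_ne (by simpa using this) (by simp)]
        exact hX l hl
      · simpa using tg_z2 _ h
  refine tgR_trans h1 ?_
  convert tgR_had k k le_rfl _ using 1
  funext c
  simp only [tgZ, Pi.single_apply, Equiv.swap_apply_def]
  rcases c with c | c <;> simp <;> split_ifs <;> simp_all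

theorem tg_main {N S : ℕ} (hSN : S ≤ N) (M : Matrix (Fin S) (TabCol N) (ZMod 2))
    (hli : ∀ c : Fin S → ZMod 2, c ᵥ* M = 0 → c = 0)
    (hiso : ∀ i j, tgOmega (M i) (M j) = 0) : ∀ k ≤ S,
    ∃ T ∈ tableauGroup N, ∀ i : Fin S, (i : ℕ) < k →
      M i ᵥ* T = tgZ (Fin.castLE hSN i) := by
  intro k
  induction k with
  | zero => exact fun _ => ⟨1, one_mem _, by simp⟩
  | succ k ih =>
    intro hk
    obtain ⟨T, hT, hrow⟩ := ih (by omega)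
    let κ : Fin S := ⟨k, hk⟩
    have hX : ∀ j < Fin.castLE hSN κ, (M κ ᵥ* T) (Sum.inl j) = 0 := by
      intro j hj
      have hjk : (j : ℕ) < k := hj
      have h := hiso κ ⟨j, by omega⟩
      rw [← tg_omega hT, hrow ⟨j, by omega⟩ hjk] at h
      simpa [tgOmega, tgZ, Pi.single_apply] using h
    have hne : ∃ j, Fin.castLE hSN κ ≤ j ∧
        ((M κ ᵥ* T) (Sum.inl j) ≠ 0 ∨ (M κ ᵥ* T) (Sum.inr j) ≠ 0) := by
      by_contra hcon
      push Not at hcon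
      let c : Fin S → ZMod 2 := fun i =>
        if i < κ then (M κ ᵥ* T) (Sum.inr (Fin.castLE hSN i)) else if i = κ then 1 else 0
      have hc : c ᵥ* M = 0 := by
        apply tg_inj hT
        have hsum : c ᵥ* M ᵥ* T = ∑ i, c i • (M i ᵥ* T) := by
          rw [vecMul_vecMul, vecMul_eq_sum]
          rfl
        have hsplit : ∀ i, c i • (M i ᵥ* T) =
            (if i < κ then (M κ ᵥ* T) (Sum.inr (Fin.castLE hSN i)) • tgZ (Fin.castLE hSN i)
              else 0) + (if i = κ then M κ ᵥ* T else 0) := by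
          intro i
          by_cases h : i < κ
          · simp [c, h, h.ne, hrow i h]
          · by_cases h' : i = κ
            · subst h'; simp [c]
            · simp [c, h, h']
        rw [hsum, Finset.sum_congr rfl fun i _ => hsplit i, Finset.sum_add_distrib]
        simp only [Finset.sum_ite_eq', Finset.mem_univ, if_true]
        funext d
        rw [Pi.add_apply, Finset.sum_apply, Pi.zero_apply]
        rcases d with d | d
        · have h0 : (M κ ᵥ* T) (Sum.inl d) = 0 := by
            by_cases h : d < Fin.castLE hSN κ
            · exact hX d h
            · exact (hcon d (not_lt.1 h)).1
          rw [h0, add_zero]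
          refine Finset.sum_eq_zero fun i _ => ?_
          split_ifs <;> simp [tgZ]
        · by_cases h : d < Fin.castLE hSN κ
          · have hd : (d : ℕ) < k := h
            rw [Finset.sum_eq_single (⟨d, by omega⟩ : Fin S)]
            · have h2 : (⟨d, by omega⟩ : Fin S) < κ := hd
              have h3 : Fin.castLE hSN (⟨d, by omega⟩ : Fin S) = d := rfl
              rw [if_pos h2, h3]
              simp [tgZ, CharTwo.add_self_eq_zero]
            · intro i _ hi
              have : d ≠ Fin.castLE hSN i := by
                rintro rfl; exact hi rfl
              split_ifs <;> simp [tgZ, Pi.single_apply, this]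
            · simp
          · rw [(hcon d (not_lt.1 h)).2, add_zero]
            refine Finset.sum_eq_zero fun i _ => ?_
            split_ifs with hi
            · have : d ≠ Fin.castLE hSN i := by
                rintro rfl; exact h hi
              simp [tgZ, Pi.single_apply, this]
            · rfl
      have := congrFun (hli c hc) κ
      simp [c] at this
    obtain ⟨U, hU, hfix, hw⟩ := tg_step _ _ hX hne
    refine ⟨T * U, mul_mem hT hU, fun i hi => ?_⟩
    rw [← vecMul_vecMul]
    by_cases h : (i : ℕ) < k
    · rw [hrow i h, hfix _ h]
    · have : i = κ := Fin.ext (by simp [κ]; omega)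
      rw [this, hw]

theorem tableau_canonical_form (N S : ℕ) (hS : 0 < S) (hN : 0 < N) (hSN : S ≤ N)
    (A B : Matrix (Fin S) (Fin N) (ZMod 2))
    (hrank : (Matrix.fromCols A B).rank = S)
    (hcomm : (A * Bᵀ).IsSymm) :
    ∃ T ∈ tableauGroup N,
      Matrix.fromCols A B * T =
        Matrix.fromCols (0 : Matrix (Fin S) (Fin N) (ZMod 2))
          (Matrix.of fun (i : Fin S) (j : Fin N) => if (j : ℕ) = (i : ℕ) then 1 else 0) := by
  have hli : ∀ c : Fin S → ZMod 2, c ᵥ* (Matrix.fromCols A B) = 0 → c = 0 := by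
    have h : LinearIndependent (ZMod 2) (Matrix.fromCols A B).row := by
      rw [linearIndependent_iff_card_eq_finrank_span, Set.finrank, ← Matrix.rank_eq_finrank_span_row, hrank]
      simp
    have h2 := Matrix.vecMul_injective_iff.2 h
    intro c hc
    exact h2 (by simpa using hc)
  have hiso : ∀ i j, tgOmega (Matrix.fromCols A B i) (Matrix.fromCols A B j) = 0 := by
    intro i j
    have h := hcomm.apply i j
    simp only [Matrix.mul_apply, Matrix.transpose_apply] at h
    simp only [tgOmega, Matrix.fromCols_apply_inl, Matrix.fromCols_apply_inr,
      Finset.sum_add_distrib]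
    rw [← h, ← Finset.sum_add_distrib]
    refine Finset.sum_eq_zero fun l _ => ?_
    rw [mul_comm (B i l)]
    exact CharTwo.add_self_eq_zero _
  obtain ⟨T, hT, hrow⟩ := tg_main hSN _ hli hiso S le_rfl
  refine ⟨T, hT, ?_⟩
  funext i c
  have h := congrFun (hrow i i.2) c
  have h' : (Matrix.fromCols A B * T) i c = tgZ (Fin.castLE hSN i) c := h
  rw [h']
  rcases c with c | c
  · simp [tgZ]
  · simp [tgZ, Pi.single_apply, Fin.ext_iff]
end

section
/- Let d be a positive integer, let H be a d×d complex Hermitian matrix, let O be a d×d complex matrix, let β be a real number, and let (v_i)_{i ∈ Fin d} be an orthonormal basis of ℂ^d. For each i set w_i = exp(-(β/2) • H) v_i, Z = trace (exp(-β • H)), Prob_i = ⟪v_i, exp(-β • H) v_i⟫ / Z, and φ_i = w_i / ‖w_i‖. Then Z > 0, each ⟪v_i, exp(-β • H) v_i⟫ is a positive real number, ∑_i Prob_i = 1, and trace (O * exp(-β • H)) / Z = ∑_{i} Prob_i • ⟪φ_i, O φ_i⟫. -/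
/-!
STATEMENT 5 (METTS decomposition): for a Hermitian `H`, any matrix `O`, a real `β` and an
orthonormal basis `(v i)` of `ℂ^d`, with `w i = exp (-(β/2) • H) (v i)`,
`Z = trace (exp (-β • H))`, `Prob i = ⟪v i, exp (-β • H) (v i)⟫ / Z` and
`φ i = w i / ‖w i‖`, one has `Z > 0`, each `⟪v i, exp (-β • H) (v i)⟫` is a positive real,
`∑ i, Prob i = 1` and `trace (O * exp (-β • H)) / Z = ∑ i, Prob i * ⟪φ i, O (φ i)⟫`.

Here `⟪u, v⟫ = star u ⬝ᵥ v` is the standard inner product on `ℂ^d` (conjugate-linear in the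
first argument), `‖w‖ = √(re ⟪w, w⟫)` the associated norm, and matrices act by `mulVec`.
-/

open Matrix

/-- The standard inner product on `ℂ^d`, conjugate-linear in the first argument. -/
noncomputable def cinner {d : ℕ} (u v : Fin d → ℂ) : ℂ := star u ⬝ᵥ v

open scoped ComplexOrder in
theorem cinner_self_pos {d : ℕ} (w : Fin d → ℂ) (hw : w ≠ 0) :
    0 < (cinner w w).re ∧ (cinner w w).im = 0 := by
  have h : 0 < star w ⬝ᵥ w := dotProduct_star_self_pos_iff.mpr hw
  have h2 := Complex.lt_def.mp h
  exact ⟨by simpa [cinner] using h2.1, by simpa [cinner] using h2.2.symm⟩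

theorem trace_eq_sum_cinner {d : ℕ} (v : Fin d → (Fin d → ℂ))
    (horth : ∀ i j, cinner (v i) (v j) = if i = j then 1 else 0)
    (M : Matrix (Fin d) (Fin d) ℂ) :
    M.trace = ∑ i, cinner (v i) (M.mulVec (v i)) := by
  let U : Matrix (Fin d) (Fin d) ℂ := Matrix.of fun j i => v i j
  have h1 : Uᴴ * U = 1 := by
    ext i j
    rw [Matrix.one_apply, ← horth i j]
    simp [U, Matrix.mul_apply, cinner, dotProduct]
  have h2 : U * Uᴴ = 1 := mul_eq_one_comm.mp h1
  have h3 : M.trace = (Uᴴ * (M * U)).trace := by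
    rw [Matrix.trace_mul_comm, Matrix.mul_assoc, h2, Matrix.mul_one]
  rw [h3]
  simp [U, Matrix.trace, Matrix.mul_apply, cinner, dotProduct, Matrix.mulVec]

theorem cinner_herm {d : ℕ} (A O : Matrix (Fin d) (Fin d) ℂ) (hA : Aᴴ = A) (x : Fin d → ℂ) :
    cinner (A.mulVec x) (O.mulVec (A.mulVec x)) = cinner x ((A * O * A).mulVec x) := by
  unfold cinner
  rw [Matrix.star_mulVec, hA, ← Matrix.dotProduct_mulVec, Matrix.mulVec_mulVec,
    Matrix.mulVec_mulVec, Matrix.mul_assoc]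

theorem metts_decomposition
    (d : ℕ) (hd : 0 < d) (H O : Matrix (Fin d) (Fin d) ℂ)
    (hH : H.IsHermitian) (β : ℝ)
    (v : Fin d → (Fin d → ℂ))
    (horth : ∀ i j, cinner (v i) (v j) = if i = j then 1 else 0) :
    let E : Matrix (Fin d) (Fin d) ℂ := NormedSpace.exp ((-β : ℝ) • H)
    let Ehalf : Matrix (Fin d) (Fin d) ℂ := NormedSpace.exp ((-(β / 2) : ℝ) • H)
    let Z : ℂ := E.trace
    let w : Fin d → (Fin d → ℂ) := fun i => Ehalf.mulVec (v i)
    let Prob : Fin d → ℂ := fun i => cinner (v i) (E.mulVec (v i)) / Z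
    let φ : Fin d → (Fin d → ℂ) :=
      fun i => ((Real.sqrt ((cinner (w i) (w i)).re) : ℝ) : ℂ)⁻¹ • w i
    (0 < Z.re ∧ Z.im = 0) ∧
    (∀ i, 0 < (cinner (v i) (E.mulVec (v i))).re ∧
      (cinner (v i) (E.mulVec (v i))).im = 0) ∧
    (∑ i, Prob i) = 1 ∧
    (O * E).trace / Z = ∑ i, Prob i * cinner (φ i) (O.mulVec (φ i)) := by
  intro E Ehalf Z w Prob φ
  have hE : E = Ehalf * Ehalf := by
    have := Matrix.exp_add_of_commute ((-(β / 2) : ℝ) • H) ((-(β / 2) : ℝ) • H) (Commute.refl _)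
    rw [← add_smul] at this
    simp only [E, Ehalf, ← this]
    congr 2
    ring
  have hherm : Ehalfᴴ = Ehalf := by
    apply Matrix.IsHermitian.exp
    unfold Matrix.IsHermitian
    rw [Matrix.conjTranspose_smul, hH.eq]
    simp
  have hw : ∀ i, w i ≠ 0 := by
    intro i h0
    have hu : IsUnit Ehalf := Matrix.isUnit_exp _
    have hv : v i = 0 := by
      apply Matrix.mulVec_injective_of_isUnit hu
      simpa [w] using h0
    have := horth i i
    simp [hv, cinner] at this
  have hww : ∀ i, cinner (v i) (E.mulVec (v i)) = cinner (w i) (w i) := by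
    intro i
    have := cinner_herm Ehalf 1 hherm (v i)
    rw [Matrix.one_mulVec, Matrix.mul_one, ← hE] at this
    exact this.symm
  have hpos : ∀ i, 0 < (cinner (v i) (E.mulVec (v i))).re ∧
      (cinner (v i) (E.mulVec (v i))).im = 0 := by
    intro i
    rw [hww i]
    exact cinner_self_pos _ (hw i)
  have hZ : Z = ∑ i, cinner (v i) (E.mulVec (v i)) := trace_eq_sum_cinner v horth E
  have hZpos : 0 < Z.re ∧ Z.im = 0 := by
    rw [hZ, Complex.re_sum, Complex.im_sum]
    exact ⟨Finset.sum_pos (fun i _ => (hpos i).1) ⟨⟨0, hd⟩, Finset.mem_univ _⟩,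
      Finset.sum_eq_zero fun i _ => (hpos i).2⟩
  have hZ0 : Z ≠ 0 := by
    intro h
    have := hZpos.1
    simp [h] at this
  refine ⟨hZpos, hpos, ?_, ?_⟩
  · simp only [Prob]
    rw [← Finset.sum_div, ← hZ, div_self hZ0]
  · have ht : (O * E).trace = ∑ i, cinner (w i) (O.mulVec (w i)) := by
      rw [hE, ← Matrix.mul_assoc, Matrix.trace_mul_comm, ← Matrix.mul_assoc,
        trace_eq_sum_cinner v horth]
      exact Finset.sum_congr rfl fun i _ => (cinner_herm Ehalf O hherm (v i)).symm
    rw [ht, Finset.sum_div]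
    refine Finset.sum_congr rfl fun i _ => ?_
    obtain ⟨hp, him⟩ := cinner_self_pos _ (hw i)
    set r := (cinner (w i) (w i)).re with hr
    have hc : cinner (w i) (w i) = ((Real.sqrt r : ℝ) : ℂ) * ((Real.sqrt r : ℝ) : ℂ) := by
      rw [← Complex.ofReal_mul, Real.mul_self_sqrt hp.le]
      apply Complex.ext <;> simp [hr, him]
    have hs : ((Real.sqrt r : ℝ) : ℂ) ≠ 0 := by
      exact_mod_cast (Real.sqrt_pos.mpr hp).ne'
    have hφ : cinner (φ i) (O.mulVec (φ i)) = ((Real.sqrt r : ℝ) : ℂ)⁻¹ *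
        (((Real.sqrt r : ℝ) : ℂ)⁻¹ * cinner (w i) (O.mulVec (w i))) := by
      simp only [φ, hr, cinner, Matrix.mulVec_smul, star_smul, smul_dotProduct,
        dotProduct_smul, smul_eq_mul]
      simp
    rw [hφ]
    simp only [Prob]
    rw [hww i, hc]
    field_simp
end

section
/- Let d be a positive integer, let H and O be d×d complex Hermitian matrices, let β be a real number, and let (v_i)_{i ∈ Fin d} be an orthonormal basis of ℂ^d. With Z = trace (exp(-β • H)), Prob_i = ⟪v_i, exp(-β • H) v_i⟫ / Z, and φ_i = exp(-(β/2) • H) v_i / ‖exp(-(β/2) • H) v_i‖, define the chain variance σ_μ² = ∑_i Prob_i • (re ⟪φ_i, O φ_i⟫)² − (∑_i Prob_i • re ⟪φ_i, O φ_i⟫)², the average shot variance σ_shot² = ∑_i Prob_i • (re ⟪φ_i, O² φ_i⟫ − (re ⟪φ_i, O φ_i⟫)²), and the Gibbs variance σ_Gibbs² = re (trace (O² * exp(-β • H))) / Z − (re (trace (O * exp(-β • H))) / Z)². Then σ_μ² + σ_shot² = σ_Gibbs². -/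
/-!
STATEMENT 7: for Hermitian `H` and `O`, a real `β` and an orthonormal basis `(v i)` of `ℂ^d`,
with `Z = trace (exp (-β • H))`, `Prob i = ⟪v i, exp (-β • H) (v i)⟫ / Z` and
`φ i = exp (-(β/2) • H) (v i) / ‖exp (-(β/2) • H) (v i)‖`, the METTS chain variance plus the
average single-shot variance equals the Gibbs variance:
`σ_μ² + σ_shot² = σ_Gibbs²`.

Here `⟪u, v⟫ = star u ⬝ᵥ v` is the standard inner product on `ℂ^d`, `re` the real part,
and matrices act by `mulVec`.
-/

open Matrix

theorem cinner_mulVec_left {d : ℕ} (A : Matrix (Fin d) (Fin d) ℂ) (hA : A.IsHermitian)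
    (u w : Fin d → ℂ) : cinner (A.mulVec u) w = cinner u (A.mulVec w) := by
  unfold cinner
  rw [Matrix.star_mulVec, hA.eq, ← Matrix.dotProduct_mulVec]

theorem sum_cinner_eq_trace {d : ℕ} (M : Matrix (Fin d) (Fin d) ℂ)
    (v : Fin d → (Fin d → ℂ))
    (horth : ∀ i j, cinner (v i) (v j) = if i = j then 1 else 0) :
    ∑ i, cinner (v i) (M.mulVec (v i)) = M.trace := by
  let V : Matrix (Fin d) (Fin d) ℂ := Matrix.of fun a i => v i a
  have h1 : Vᴴ * V = 1 := by
    ext i j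
    rw [Matrix.one_apply, ← horth i j]
    rfl
  have h2 : V * Vᴴ = 1 := mul_eq_one_comm.mp h1
  have h3 : (Vᴴ * (M * V)).trace = M.trace := by
    rw [Matrix.trace_mul_comm, Matrix.mul_assoc, h2, Matrix.mul_one]
  rw [← h3]
  rfl

open scoped ComplexOrder in
theorem shot_eq {d : ℕ} (A : Matrix (Fin d) (Fin d) ℂ) (w : Fin d → ℂ) :
    (cinner w w).re * (cinner (((Real.sqrt ((cinner w w).re) : ℝ) : ℂ)⁻¹ • w)
      (A.mulVec (((Real.sqrt ((cinner w w).re) : ℝ) : ℂ)⁻¹ • w))).re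
      = (cinner w (A.mulVec w)).re := by
  have hnn : 0 ≤ cinner w w := dotProduct_star_self_nonneg w
  have hre : 0 ≤ (cinner w w).re := (Complex.le_def.mp hnn).1
  have him : (cinner w w).im = 0 := (Complex.le_def.mp hnn).2.symm
  by_cases h0 : (cinner w w).re = 0
  · have hz : cinner w w = 0 := Complex.ext h0 him
    have hw : w = 0 := dotProduct_star_self_eq_zero.mp hz
    subst hw
    simp [cinner]
  · have hs := Real.mul_self_sqrt hre
    have hs0 : Real.sqrt ((cinner w w).re) ≠ 0 := by
      intro h
      rw [h] at hs
      exact h0 (by linarith)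
    generalize hr : Real.sqrt ((cinner w w).re) = r at *
    rw [← hs]
    have : cinner (((r : ℝ) : ℂ)⁻¹ • w) (A.mulVec (((r : ℝ) : ℂ)⁻¹ • w))
        = ((r⁻¹ * r⁻¹ : ℝ) : ℂ) * cinner w (A.mulVec w) := by
      simp [cinner, Matrix.mulVec_smul, star_smul, mul_assoc]
    rw [this, Complex.re_ofReal_mul]
    field_simp

theorem metts_variance_decomposition
    (d : ℕ) (hd : 0 < d) (H O : Matrix (Fin d) (Fin d) ℂ)
    (hH : H.IsHermitian) (hO : O.IsHermitian) (β : ℝ)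
    (v : Fin d → (Fin d → ℂ))
    (horth : ∀ i j, cinner (v i) (v j) = if i = j then 1 else 0) :
    let E : Matrix (Fin d) (Fin d) ℂ := NormedSpace.exp ((-β : ℝ) • H)
    let Ehalf : Matrix (Fin d) (Fin d) ℂ := NormedSpace.exp ((-(β / 2) : ℝ) • H)
    let Z : ℂ := E.trace
    let w : Fin d → (Fin d → ℂ) := fun i => Ehalf.mulVec (v i)
    let φ : Fin d → (Fin d → ℂ) :=
      fun i => ((Real.sqrt ((cinner (w i) (w i)).re) : ℝ) : ℂ)⁻¹ • w i
    let Prob : Fin d → ℝ := fun i => (cinner (v i) (E.mulVec (v i)) / Z).re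
    let μ : Fin d → ℝ := fun i => (cinner (φ i) (O.mulVec (φ i))).re
    let m2 : Fin d → ℝ := fun i => (cinner (φ i) ((O * O).mulVec (φ i))).re
    let σμ2 : ℝ := (∑ i, Prob i * (μ i) ^ 2) - (∑ i, Prob i * μ i) ^ 2
    let σshot2 : ℝ := ∑ i, Prob i * (m2 i - (μ i) ^ 2)
    let σGibbs2 : ℝ := ((O * O * E).trace).re / Z.re - (((O * E).trace).re / Z.re) ^ 2
    σμ2 + σshot2 = σGibbs2 := by
  intro E Ehalf Z w φ Prob μ m2 σμ2 σshot2 σGibbs2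
  have hEh : Ehalf.IsHermitian := by
    apply Matrix.IsHermitian.exp
    unfold Matrix.IsHermitian
    rw [Matrix.conjTranspose_smul, hH.eq, star_trivial]
  have hE : E = Ehalf * Ehalf := by
    simp only [E, Ehalf]
    rw [← Matrix.exp_add_of_commute _ _ (Commute.refl _), ← add_smul]
    congr 2
    ring
  have hEH : E.IsHermitian := by
    unfold Matrix.IsHermitian
    rw [hE, Matrix.conjTranspose_mul, hEh.eq]
  have hZim : Z.im = 0 := by
    have h : star Z = Z := by
      simp only [Z]
      rw [← Matrix.trace_conjTranspose, hEH.eq]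
    exact Complex.conj_eq_iff_im.mp h
  have hZ : Z = ((Z.re : ℝ) : ℂ) := Complex.ext (by simp) (by simp [hZim])
  have hP : ∀ i, Prob i = (cinner (w i) (w i)).re / Z.re := by
    intro i
    simp only [Prob, w]
    rw [cinner_mulVec_left _ hEh, Matrix.mulVec_mulVec, ← hE, hZ, Complex.div_ofReal_re,
      Complex.ofReal_re]
  have key : ∀ A : Matrix (Fin d) (Fin d) ℂ,
      ∑ i, Prob i * (cinner (φ i) (A.mulVec (φ i))).re = ((A * E).trace).re / Z.re := by
    intro A
    have h1 : ∀ i, Prob i * (cinner (φ i) (A.mulVec (φ i))).re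
        = (cinner (v i) ((Ehalf * (A * Ehalf)).mulVec (v i))).re / Z.re := by
      intro i
      rw [hP, div_mul_eq_mul_div, shot_eq A (w i)]
      simp only [w]
      rw [cinner_mulVec_left _ hEh, Matrix.mulVec_mulVec, Matrix.mulVec_mulVec, Matrix.mul_assoc]
    rw [Finset.sum_congr rfl (fun i _ => h1 i), ← Finset.sum_div, ← Complex.re_sum,
      sum_cinner_eq_trace _ v horth, Matrix.trace_mul_comm, Matrix.mul_assoc, ← hE]
  have k1 : ∑ i, Prob i * μ i = ((O * E).trace).re / Z.re := key O
  have k2 : ∑ i, Prob i * m2 i = ((O * O * E).trace).re / Z.re := key (O * O)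
  simp only [σμ2, σshot2, σGibbs2]
  rw [← k1, ← k2]
  simp only [mul_sub, Finset.sum_sub_distrib]
  ring
end
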